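/- Let p be an odd prime and m ≥ 2 an integer. For an integer j, let ℓ₁ denote the unique integer in [0, p−2] with ℓ₁ ≡ m(p−2) (mod p−1), and let ℓ₀(j) denote the unique integer in [0, p−2] with ℓ₀(j) ≡ m − j − ⌈(2m+j)/p⌉ (mod p−1). Define, for 0 ≤ a ≤ p−2, ψ(a,j) = 1 if a < ℓ₀(j)+1 and p−1−ℓ₁ ≤ a ≤ p−2; ψ(a,j) = −1 if a < p−1−ℓ₁ and ℓ₀(j)+1 ≤ a ≤ p−2; and ψ(a,j) = 0 otherwise. For 1 ≤ b ≤ p−1, define σ(b) = 1 if either (2m+b−1 ≡ 0 (mod p) and ℓ₀(b−1) ∈ {0,1}) or (2m+b−1 ≢ 0 (mod p) and ℓ₀(b−1) = 0), and σ(b) = 0 otherwise; and define n(a,b) = σ(b) + ψ(a,b−1) − ψ(a,b). Then for every b with 1 ≤ b ≤ p−1: every n(a,b) lies in {0,1}; if 2m+b−1 ≢ 0 (mod p) there is exactly one a in [0, p−2] with n(a,b) = 1; and if 2m+b−1 ≡ 0 (mod p) there are exactly two distinct values a in [0, p−2] with n(a,b) = 1. -/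

import Mathlib

/-- The function `ψ(a, j)` from the decomposition of `H⁰(C, Ω_C^{⊗m})` as an
`𝔽[B]`-module for the Drinfeld curve with `q = p`.  Here `ℓ₁ = ℓ_{[1:0],j}` and
`ℓ₀ j = ℓ_{[0:1],j}`. -/
def psi (p : ℕ) (ℓ₁ : ℤ) (ℓ₀ : ℤ → ℤ) (a j : ℤ) : ℤ :=
  if a < ℓ₀ j + 1 ∧ (p : ℤ) - 1 - ℓ₁ ≤ a ∧ a ≤ (p : ℤ) - 2 then 1
  else if a < (p : ℤ) - 1 - ℓ₁ ∧ ℓ₀ j + 1 ≤ a ∧ a ≤ (p : ℤ) - 2 then -1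
  else 0

/-- The function `σ(b)`: it is `1` if either `2m+b−1 ≡ 0 (mod p)` and
`ℓ₀(b−1) ∈ {0,1}`, or `2m+b−1 ≢ 0 (mod p)` and `ℓ₀(b−1) = 0`; else `0`. -/
def sigmaB (p m : ℕ) (ℓ₀ : ℤ → ℤ) (b : ℤ) : ℤ :=
  if ((p : ℤ) ∣ (2 * (m : ℤ) + b - 1) ∧ (ℓ₀ (b - 1) = 0 ∨ ℓ₀ (b - 1) = 1))
      ∨ (¬ (p : ℤ) ∣ (2 * (m : ℤ) + b - 1) ∧ ℓ₀ (b - 1) = 0) then 1 else 0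

/-- The multiplicity `n_{a,b} = σ(b) + ψ(a,b−1) − ψ(a,b)` of the indecomposable
`𝔽[B]`-module `U_{a,b}` in `Res^G_B H⁰(C, Ω_C^{⊗m})`. -/
def nab (p m : ℕ) (ℓ₁ : ℤ) (ℓ₀ : ℤ → ℤ) (a b : ℤ) : ℤ :=
  sigmaB p m ℓ₀ b + psi p ℓ₁ ℓ₀ a (b - 1) - psi p ℓ₁ ℓ₀ a b

theorem psi_eq_sub (p : ℕ) (ℓ₁ : ℤ) (ℓ₀ : ℤ → ℤ) {a : ℤ} (ha : a ≤ (p : ℤ) - 2) (j : ℤ) :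
    psi p ℓ₁ ℓ₀ a j =
      (if a ≤ ℓ₀ j then 1 else 0) - (if a < (p : ℤ) - 1 - ℓ₁ then 1 else 0) := by
  unfold psi
  split_ifs <;> omega

theorem mul_ceil_intCast_div_bounds {p : ℕ} (hp : 0 < p) (n : ℤ) :
    (p : ℤ) * (⌈(n : ℚ) / p⌉ - 1) < n ∧ n ≤ p * ⌈(n : ℚ) / p⌉ := by
  have hp' : (0 : ℚ) < p := by exact_mod_cast hp
  have h := (Int.ceil_eq_iff (a := (n : ℚ) / p)).1 rfl
  rw [lt_div_iff₀ hp', div_le_iff₀ hp'] at h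
  constructor
  · rw [mul_comm]; exact_mod_cast h.1
  · rw [mul_comm]; exact_mod_cast h.2

theorem ceil_intCast_succ_div {p : ℕ} (hp : 0 < p) (n : ℤ) :
    ⌈((n + 1 : ℤ) : ℚ) / p⌉ = ⌈(n : ℚ) / p⌉ + if (p : ℤ) ∣ n then 1 else 0 := by
  have hp' : (0 : ℤ) < p := by exact_mod_cast hp
  obtain ⟨h₁, h₂⟩ := mul_ceil_intCast_div_bounds hp n
  obtain ⟨h₃, h₄⟩ := mul_ceil_intCast_div_bounds hp (n + 1)
  generalize ⌈((n + 1 : ℤ) : ℚ) / p⌉ = y at *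
  generalize ⌈(n : ℚ) / p⌉ = x at *
  split_ifs with hd
  · obtain ⟨k, rfl⟩ := hd
    have e₁ : x - 1 < k := by nlinarith
    have e₂ : k ≤ x := by nlinarith
    have e₃ : k < y := by nlinarith
    have e₄ : y - 1 < k + 1 := by nlinarith
    omega
  · have hne : n ≠ p * x := fun h => hd ⟨x, h⟩
    have hlt : n < p * x := lt_of_le_of_ne h₂ hne
    have e₁ : y - 1 < x := by nlinarith
    have e₂ : x - 1 < y := by nlinarith
    omega

/-- Two residues in `[0, N)` differing by `d ∈ [0, N]` modulo `N`. -/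
theorem eq_sub_or_eq_sub_add_of_modEq {N x y d : ℤ} (hx : 0 ≤ x) (hxN : x < N)
    (hy : 0 ≤ y) (hyN : y < N) (hd : 0 ≤ d) (hdN : d ≤ N) (h : y ≡ x - d [ZMOD N]) :
    y = x - d ∨ y = x - d + N := by
  obtain ⟨k, hk⟩ := h.dvd
  have h₁ : -2 < k := by nlinarith
  have h₂ : k < 1 := by nlinarith
  obtain rfl | rfl : k = 0 ∨ k = -1 := by omega
  · left; linarith
  · right; linarith

/-- Each `n(a,b)` lies in `{0,1}`; there is exactly one `a` with
`n(a,b) = 1` when `2m+b−1 ≢ 0 (mod p)`, and exactly two such `a` otherwise. -/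
theorem nab_zero_or_one (p m : ℕ) (hp : p.Prime) (hodd : Odd p) (hm : 2 ≤ m)
    (ℓ₁ : ℤ) (hℓ₁0 : 0 ≤ ℓ₁) (hℓ₁2 : ℓ₁ ≤ (p : ℤ) - 2)
    (hℓ₁ : ℓ₁ ≡ (m : ℤ) * ((p : ℤ) - 2) [ZMOD (p : ℤ) - 1])
    (ℓ₀ : ℤ → ℤ) (hℓ₀0 : ∀ j, 0 ≤ ℓ₀ j) (hℓ₀2 : ∀ j, ℓ₀ j ≤ (p : ℤ) - 2)
    (hℓ₀ : ∀ j : ℤ,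
      ℓ₀ j ≡ (m : ℤ) - j - ⌈(2 * (m : ℚ) + (j : ℚ)) / (p : ℚ)⌉ [ZMOD (p : ℤ) - 1])
    :
    ∀ b : ℤ, 1 ≤ b → b ≤ (p : ℤ) - 1 →
      (∀ a : ℤ, 0 ≤ a → a ≤ (p : ℤ) - 2 →
        nab p m ℓ₁ ℓ₀ a b = 0 ∨ nab p m ℓ₁ ℓ₀ a b = 1) ∧
      (¬ (p : ℤ) ∣ (2 * (m : ℤ) + b - 1) →
        ((Finset.Icc (0 : ℤ) ((p : ℤ) - 2)).filter
          (fun a => nab p m ℓ₁ ℓ₀ a b = 1)).card = 1) ∧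
      ((p : ℤ) ∣ (2 * (m : ℤ) + b - 1) →
        ((Finset.Icc (0 : ℤ) ((p : ℤ) - 2)).filter
          (fun a => nab p m ℓ₁ ℓ₀ a b = 1)).card = 2) := by
  intro b _ _
  have h₃ : 3 ≤ p := by
    have := hp.two_le
    obtain ⟨k, rfl⟩ := hodd
    omega
  have hstep := ceil_intCast_succ_div hp.pos (2 * (m : ℤ) + b - 1)
  have hx := hℓ₀ (b - 1)
  have hy := hℓ₀ b
  rw [show 2 * (m : ℚ) + ((b - 1 : ℤ) : ℚ) = ((2 * (m : ℤ) + b - 1 : ℤ) : ℚ) by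
    push_cast; ring] at hx
  rw [show 2 * (m : ℚ) + (b : ℚ) = ((2 * (m : ℤ) + b - 1 + 1 : ℤ) : ℚ) by
    push_cast; ring, hstep] at hy
  have hrec : ℓ₀ b ≡ ℓ₀ (b - 1) - (1 + if (p : ℤ) ∣ 2 * (m : ℤ) + b - 1 then 1 else 0)
      [ZMOD (p : ℤ) - 1] := by
    refine hy.trans ?_
    convert (hx.symm.sub_right _) using 1
    ring
  have hx₀ := hℓ₀0 (b - 1)
  have hx₂ := hℓ₀2 (b - 1)
  have hy₀ := hℓ₀0 b
  have hy₂ := hℓ₀2 b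
  have hcases := eq_sub_or_eq_sub_add_of_modEq hx₀ (by omega) hy₀ (by omega)
    (by split_ifs <;> omega) (by split_ifs <;> omega) hrec
  by_cases hd : (p : ℤ) ∣ 2 * (m : ℤ) + b - 1
  · set u : ℤ := if ℓ₀ (b - 1) = 0 then (p : ℤ) - 2 else ℓ₀ (b - 1) - 1 with hu
    have hnab : ∀ a : ℤ, 0 ≤ a → a ≤ (p : ℤ) - 2 →
        nab p m ℓ₁ ℓ₀ a b = if a = ℓ₀ (b - 1) ∨ a = u then 1 else 0 := by
      intro a ha₀ ha₂
      simp only [nab, sigmaB, psi_eq_sub p ℓ₁ ℓ₀ ha₂, hd, if_true, true_and, not_true,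
        false_and, or_false] at hcases ⊢
      split_ifs at * <;> omega
    refine ⟨fun a ha₀ ha₂ => ?_, fun h => absurd hd h, fun _ => ?_⟩
    · rw [hnab a ha₀ ha₂]
      split_ifs <;> simp
    · have hne : ℓ₀ (b - 1) ≠ u := by split_ifs at hu <;> omega
      rw [← Finset.card_pair hne]
      congr 1
      ext a
      simp only [Finset.mem_filter, Finset.mem_Icc, Finset.mem_insert, Finset.mem_singleton]
      constructor
      · rintro ⟨⟨ha₀, ha₂⟩, h⟩
        rw [hnab a ha₀ ha₂] at h
        by_contra hc
        simp [hc] at h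
      · intro h
        have ha : 0 ≤ a ∧ a ≤ (p : ℤ) - 2 := by split_ifs at hu <;> omega
        exact ⟨ha, by rw [hnab a ha.1 ha.2, if_pos h]⟩
  · have hnab : ∀ a : ℤ, 0 ≤ a → a ≤ (p : ℤ) - 2 →
        nab p m ℓ₁ ℓ₀ a b = if a = ℓ₀ (b - 1) then 1 else 0 := by
      intro a ha₀ ha₂
      simp only [nab, sigmaB, psi_eq_sub p ℓ₁ ℓ₀ ha₂, hd, if_false, false_and, not_false_eq_true,
        true_and, false_or] at hcases ⊢
      split_ifs at * <;> omega
    refine ⟨fun a ha₀ ha₂ => ?_, fun _ => ?_, fun h => absurd h hd⟩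
    · rw [hnab a ha₀ ha₂]
      split_ifs <;> simp
    · rw [Finset.card_eq_one]
      refine ⟨ℓ₀ (b - 1), ?_⟩
      ext a
      simp only [Finset.mem_filter, Finset.mem_Icc, Finset.mem_singleton]
      constructor
      · rintro ⟨⟨ha₀, ha₂⟩, h⟩
        rw [hnab a ha₀ ha₂] at h
        by_contra hc
        simp [hc] at h
      · rintro rfl
        exact ⟨⟨hx₀, hx₂⟩, by rw [hnab _ hx₀ hx₂, if_pos rfl]⟩
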